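/- arXiv:1907.03681 — 10 statements merged into one kernel-verified Lean document; each statement's English description precedes it below -/
import Mathlib

section
/- Let X be a finite T₀-space and let f : X → X be a continuous map. If there exists x ∈ X such that the subspace Û_x = U_x \ {x} has the fixed point property and f(Û_x) ⊆ U_x, then f has a fixed point. Dually, if there exists x ∈ X such that the subspace F̂_x = F_x \ {x} has the fixed point property and f(F̂_x) ⊆ F_x, then f has a fixed point. -/
open Set

/-- The Alexandrov topology on a preorder whose open sets are exactly the lower (down) sets;
the minimal open set containing `x` is `U_x = Set.Iic x`. -/
def lowerTop (α : Type*) [Preorder α] : TopologicalSpace α where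
  IsOpen s := IsLowerSet s
  isOpen_univ := isLowerSet_univ
  isOpen_inter := fun _ _ hs ht => hs.inter ht
  isOpen_sUnion := fun _ h => isLowerSet_sUnion h

/-- A topological space has the fixed point property iff every continuous self-map has a
fixed point. -/
def HasFPP (X : Type*) [TopologicalSpace X] : Prop :=
  ∀ f : X → X, Continuous f → ∃ x, f x = x

/-- The fixed point property for a subspace of a poset endowed with the lower-set topology. -/
def SubFPP {α : Type*} [Preorder α] (C : Set α) : Prop :=
  letI := lowerTop α
  HasFPP C

/-- The fixed point property of a poset regarded as a T₀-space (lower-set topology). -/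
def PosetFPP (P : Type*) [Preorder P] : Prop :=
  letI := lowerTop P
  HasFPP P

/-- Connectedness of a poset regarded as a T₀-space (lower-set topology). -/
def PosetConnected (α : Type*) [Preorder α] : Prop :=
  letI := lowerTop α
  ConnectedSpace α

/-- A nonempty connected subspace (lower-set topology). -/
def ConnSet {α : Type*} [Preorder α] (B : Set α) : Prop :=
  letI := lowerTop α
  IsConnected B

/-- `U_A = ⋂_{a ∈ A} U_a`. -/
def UA {α : Type*} [Preorder α] (A : Set α) : Set α := ⋂ a ∈ A, Iic a

/-- `F_A = ⋂_{a ∈ A} F_a`. -/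
def FA {α : Type*} [Preorder α] (A : Set α) : Set α := ⋂ a ∈ A, Ici a

/-- The set of connected components of the subspace `S` (lower-set topology). -/
def CC {α : Type*} [Preorder α] (S : Set α) : Set (Set α) :=
  letI := lowerTop α
  {C | ∃ x ∈ S, C = connectedComponentIn S x}

/-- `𝒰(X)`: connected components of the nonempty sets `U_A`, `A` a nonempty set of maximal
elements. -/
def scrU (α : Type*) [Preorder α] : Set (Set α) :=
  {C | ∃ A : Set α, A.Nonempty ∧ (∀ a ∈ A, IsMax a) ∧ C ∈ CC (UA A)}

/-- `ℱ(X)`: connected components of the nonempty sets `F_A`, `A` a nonempty set of minimal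
elements. -/
def scrF (α : Type*) [Preorder α] : Set (Set α) :=
  {C | ∃ A : Set α, A.Nonempty ∧ (∀ a ∈ A, IsMin a) ∧ C ∈ CC (FA A)}

/-- `𝒞(X) = 𝒰(X) ∪ ℱ(X)`. -/
def scrC (α : Type*) [Preorder α] : Set (Set α) := scrU α ∪ scrF α

/-- The partial order on `𝒞(X)`. -/
def cleq (α : Type*) [Preorder α] (C₁ C₂ : Set α) : Prop :=
  (C₁ ∈ scrU α ∧ C₂ ∈ scrU α ∧ C₁ ⊆ C₂) ∨
  (C₁ ∈ scrF α ∧ C₂ ∈ scrF α ∧ C₂ ⊆ C₁) ∨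
  (C₁ ∈ scrF α ∧ C₂ ∈ scrU α ∧ (C₁ ∩ C₂).Nonempty)

/-- `UImage f C D` says that `D = 𝒰(f)(C) = min {D ∈ 𝒰(Y) ∣ f(C) ⊆ D}` (min w.r.t. `⊆`). -/
def UImage {α β : Type*} [Preorder α] [Preorder β] (f : α → β) (C : Set α) (D : Set β) : Prop :=
  D ∈ scrU β ∧ f '' C ⊆ D ∧ ∀ D' ∈ scrU β, f '' C ⊆ D' → D ⊆ D'

/-- `FImage f C D` says that `D = ℱ(f)(C) = max {D ∈ ℱ(Y) ∣ f(C) ⊆ D}` (max w.r.t. `⊆`). -/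
def FImage {α β : Type*} [Preorder α] [Preorder β] (f : α → β) (C : Set α) (D : Set β) : Prop :=
  D ∈ scrF β ∧ f '' C ⊆ D ∧ ∀ D' ∈ scrF β, f '' C ⊆ D' → D' ⊆ D

/-- `CImage f C D` says that `D = 𝒞(f)(C)`. -/
def CImage {α β : Type*} [Preorder α] [Preorder β] (f : α → β) (C : Set α) (D : Set β) : Prop :=
  (C ∈ scrU α ∧ UImage f C D) ∨ (C ∈ scrF α ∧ FImage f C D)

/-- `B♯ = {a maximal ∣ B ⊆ U_a}`. -/
def sharp {α : Type*} [Preorder α] (B : Set α) : Set α := {a | IsMax a ∧ B ⊆ Iic a}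

/-- `B♭ = {a minimal ∣ B ⊆ F_a}`. -/
def flat {α : Type*} [Preorder α] (B : Set α) : Set α := {a | IsMin a ∧ B ⊆ Ici a}

theorem aux_fix_up {α : Type*} [PartialOrder α] [Fintype α] (f : α → α) (hf : Monotone f)
    (y : α) (hy : y ≤ f y) : ∃ x, f x = x := by
  obtain ⟨m, hm⟩ := (Set.toFinite {z | z ≤ f z}).exists_maximal ⟨y, hy⟩
  have h1 : m ≤ f m := hm.1
  exact ⟨m, le_antisymm (hm.2 (show f m ≤ f (f m) from hf h1) h1) h1⟩

theorem aux_fix_down {α : Type*} [PartialOrder α] [Fintype α] (f : α → α) (hf : Monotone f)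
    (y : α) (hy : f y ≤ y) : ∃ x, f x = x := by
  obtain ⟨m, hm⟩ := (Set.toFinite {z | f z ≤ z}).exists_minimal ⟨y, hy⟩
  have h1 : f m ≤ m := hm.1
  exact ⟨m, le_antisymm h1 (hm.2 (show f (f m) ≤ f m from hf h1) h1)⟩

theorem aux_sub {α : Type*} [PartialOrder α] (f : α → α) (hf : Monotone f) (C : Set α)
    (hC : SubFPP C) (h : ∀ y ∈ C, f y ∈ C) : ∃ x, f x = x := by
  letI := lowerTop α
  have hc : Continuous f := ⟨fun s hs => fun a b hba ha => hs (hf hba) ha⟩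
  obtain ⟨x, hx⟩ := hC (fun y => ⟨f y, h y y.2⟩)
    (Continuous.subtype_mk (hc.comp continuous_subtype_val) _)
  exact ⟨x, congrArg Subtype.val hx⟩

/-- If `Û_x = U_x \ {x}` has the fixed point property and `f(Û_x) ⊆ U_x`
(for some `x`), then the continuous (= order-preserving) map `f` has a fixed point;
dually for `F̂_x = F_x \ {x}` and `F_x`. -/
theorem stmt0 {α : Type*} [PartialOrder α] [Fintype α] (f : α → α) (hf : Monotone f) :
    ((∃ x : α, SubFPP (Iic x \ {x}) ∧ f '' (Iic x \ {x}) ⊆ Iic x) → ∃ x, f x = x) ∧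
    ((∃ x : α, SubFPP (Ici x \ {x}) ∧ f '' (Ici x \ {x}) ⊆ Ici x) → ∃ x, f x = x) := by
  constructor
  · rintro ⟨x, hx, hsub⟩
    by_cases h : ∀ y ∈ Iic x \ {x}, f y ∈ Iic x \ {x}
    · exact aux_sub f hf _ hx h
    · push Not at h
      obtain ⟨y, hy, hn⟩ := h
      have h1 : f y ∈ Iic x := hsub ⟨y, hy, rfl⟩
      have h2 : f y = x := by
        by_contra h3
        exact hn ⟨h1, h3⟩
      exact aux_fix_up f hf y (h2.symm ▸ hy.1)
  · rintro ⟨x, hx, hsub⟩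
    by_cases h : ∀ y ∈ Ici x \ {x}, f y ∈ Ici x \ {x}
    · exact aux_sub f hf _ hx h
    · push Not at h
      obtain ⟨y, hy, hn⟩ := h
      have h1 : f y ∈ Ici x := hsub ⟨y, hy, rfl⟩
      have h2 : f y = x := by
        by_contra h3
        exact hn ⟨h1, h3⟩
      exact aux_fix_down f hf y (h2.symm ▸ hy.1)
end

section
/- Let n ∈ ℕ with n ≥ 2 and let X be a 2n-crown. If f : X → X is a continuous map that is not bijective, then f has a fixed point. -/
open Set

/-- The standard `2n`-crown relation on `Fin n ⊕ Fin n`: the points `inl i` are the bottom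
points `x i`, the points `inr j` are the top points `y j`, and the only strict relations are
`x i < y i` and `x i < y (i+1 mod n)`. -/
def crownRel (n : ℕ) : Fin n ⊕ Fin n → Fin n ⊕ Fin n → Prop
  | .inl i, .inl j => i = j
  | .inl i, .inr j => j = i ∨ (j : ℕ) = ((i : ℕ) + 1) % n
  | .inr _, .inl _ => False
  | .inr i, .inr j => i = j

/-- A poset is a `2n`-crown if it is order-isomorphic to the standard `2n`-crown. -/
def IsCrown (n : ℕ) (α : Type*) [PartialOrder α] : Prop :=
  ∃ e : α ≃ (Fin n ⊕ Fin n), ∀ a b : α, a ≤ b ↔ crownRel n (e a) (e b)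

def cphi (n : ℕ) (hn : 2 ≤ n) (k : ℕ) : Fin n ⊕ Fin n :=
  if k % 2 = 0 then .inr ⟨k / 2 % n, Nat.mod_lt _ (by omega)⟩
  else .inl ⟨k / 2 % n, Nat.mod_lt _ (by omega)⟩

lemma cphi_md (m n : ℕ) (h : m < 2 * n) : (m < n ∧ m % n = m) ∨ (n ≤ m ∧ m % n = m - n) := by
  rcases lt_or_ge m n with h1 | h1
  · exact Or.inl ⟨h1, Nat.mod_eq_of_lt h1⟩
  · refine Or.inr ⟨h1, ?_⟩
    rw [Nat.mod_eq_sub_mod h1, Nat.mod_eq_of_lt (by omega)]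

lemma cphi_adj (n : ℕ) (hn : 2 ≤ n) (k : ℕ) :
    crownRel n (cphi n hn k) (cphi n hn (k + 1)) ∨
    crownRel n (cphi n hn (k + 1)) (cphi n hn k) := by
  rcases Nat.mod_two_eq_zero_or_one k with h | h
  · right
    have h1 : (k + 1) % 2 ≠ 0 := by omega
    have h2 : (k + 1) / 2 = k / 2 := by omega
    simp [cphi, h, h1, h2, crownRel]
  · left
    have h1 : (k + 1) % 2 = 0 := by omega
    have h2 : (k + 1) / 2 = k / 2 + 1 := by omega
    simp [cphi, h, h1, h2, crownRel]

lemma cphi_near (n : ℕ) (hn : 2 ≤ n) (p a b : ℕ) (hp : p < 2 * n) (ha : 1 ≤ a) (ha' : a < 2 * n)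
    (hb : 1 ≤ b) (hb' : b < 2 * n) (h : crownRel n (cphi n hn (p + a)) (cphi n hn (p + b))) :
    a ≤ b + 1 ∧ b ≤ a + 1 := by
  have m1 := cphi_md ((p + a) / 2) n (by omega)
  have m2 := cphi_md ((p + b) / 2) n (by omega)
  have m3 := cphi_md ((p + a) / 2 % n + 1) n (by omega)
  unfold cphi at h
  split_ifs at h with h1 h2 h2 <;> simp only [crownRel, Fin.mk.injEq] at h <;> omega

lemma cphi_surj (n : ℕ) (hn : 2 ≤ n) (c : Fin n ⊕ Fin n) : ∃ k < 2 * n, cphi n hn k = c := by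
  rcases c with i | i
  · refine ⟨2 * i + 1, by omega, ?_⟩
    have h1 : (2 * (i : ℕ) + 1) % 2 ≠ 0 := by omega
    have h2 : (2 * (i : ℕ) + 1) / 2 = i := by omega
    simp [cphi, h2, Nat.mod_eq_of_lt i.2]
  · refine ⟨2 * i, by omega, ?_⟩
    simp [cphi, Nat.mod_eq_of_lt i.2]

lemma cphi_period (n : ℕ) (hn : 2 ≤ n) (k : ℕ) : cphi n hn (k + 2 * n) = cphi n hn k := by
  have h2 : (k + 2 * n) / 2 = k / 2 + n := by omega
  simp [cphi, h2]

lemma cphi_ne (n : ℕ) (hn : 2 ≤ n) (k : ℕ) : cphi n hn k ≠ cphi n hn (k + 1) := by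
  unfold cphi
  split_ifs <;> first | omega | simp

/-- a non-bijective continuous (= order-preserving) self-map of a `2n`-crown
(`n ≥ 2`) has a fixed point. -/
theorem stmt1 {α : Type*} [PartialOrder α] {n : ℕ} (hn : 2 ≤ n) (hX : IsCrown n α)
    (f : α → α) (hf : Monotone f) (hbij : ¬ Function.Bijective f) : ∃ x, f x = x := by
  obtain ⟨e, he⟩ := hX
  haveI : Finite α := Finite.of_equiv _ e.symm
  have hs : ¬ Function.Surjective f := fun h =>
    hbij ⟨Finite.injective_iff_surjective.2 h, h⟩
  simp only [Function.Surjective, not_forall, not_exists] at hs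
  obtain ⟨q, hq⟩ := hs
  obtain ⟨p, hp, hpq⟩ := cphi_surj n hn (e q)
  have key : ∀ k, ∃ g, 1 ≤ g ∧ g < 2 * n ∧ e (f (e.symm (cphi n hn (p + k)))) = cphi n hn (p + g) := by
    intro k
    obtain ⟨m, hm, hm'⟩ := cphi_surj n hn (e (f (e.symm (cphi n hn (p + k)))))
    have hne : m ≠ p := by
      rintro rfl
      exact hq _ (e.injective (hm'.symm.trans hpq))
    rcases lt_or_ge p m with h | h
    · exact ⟨m - p, by omega, by omega, by rw [← hm']; congr 1; omega⟩
    · refine ⟨m + 2 * n - p, by omega, by omega, ?_⟩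
      rw [← hm', ← cphi_period n hn m]; congr 1; omega
  choose g g1 g2 g3 using key
  have mono : ∀ a b, crownRel n (cphi n hn (p + a)) (cphi n hn (p + b)) →
      crownRel n (cphi n hn (p + g a)) (cphi n hn (p + g b)) := by
    intro a b h
    rw [← g3, ← g3, ← he]
    apply hf
    rw [he]
    simpa using h
  have anti : ∀ a b, crownRel n a b → crownRel n b a → a = b := by
    intro a b h1 h2
    have := le_antisymm ((he (e.symm a) (e.symm b)).2 (by simpa using h1))
      ((he (e.symm b) (e.symm a)).2 (by simpa using h2))
    exact e.symm.injective this
  by_contra hfix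
  push Not at hfix
  have gne : ∀ k, g k ≠ k := by
    intro k hk
    apply hfix (e.symm (cphi n hn (p + k)))
    apply e.injective
    rw [g3, hk]; simp
  have main : ∀ k, k + 1 < 2 * n → k + 1 < g (k + 1) := by
    intro k
    induction k with
    | zero => intro _; have := g1 1; have := gne 1; simp only [zero_add]; omega
    | succ k ih =>
      intro hk
      have ih := ih (by omega)
      have hn1 := gne (k + 1 + 1)
      have hadj := cphi_adj n hn (p + (k + 1))
      have hnear : g (k + 1) ≤ g (k + 1 + 1) + 1 := by
        rcases hadj with h | h
        · exact (cphi_near n hn p _ _ hp (g1 _) (g2 _) (g1 _) (g2 _) (mono (k + 1) (k + 1 + 1) h)).1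
        · exact (cphi_near n hn p _ _ hp (g1 _) (g2 _) (g1 _) (g2 _) (mono (k + 1 + 1) (k + 1) h)).2
      by_contra hcon
      have e1 : g (k + 1) = k + 1 + 1 := by omega
      have e2 : g (k + 1 + 1) = k + 1 := by omega
      apply cphi_ne n hn (p + (k + 1))
      rcases hadj with h | h
      · have h' := mono (k + 1) (k + 1 + 1) h
        rw [e1, e2] at h'
        exact anti _ _ h h'
      · have h' := mono (k + 1 + 1) (k + 1) h
        rw [e1, e2] at h'
        exact anti _ _ h' h
  have h1 := main (2 * n - 2) (by omega)
  have h2 := g2 (2 * n - 2 + 1)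
  omega
end

section
/- Let X be a connected finite T₀-space. If 𝒰(X) ∩ ℱ(X) ≠ ∅, then X has a maximum element and a minimum element, and 𝒰(X) = ℱ(X) = {X}. Moreover, for any finite T₀-space X (connected or not), if X has a maximum element then 𝒰(X) = {X}, and if X has a minimum element then ℱ(X) = {X}. -/
open Set

theorem aux_pre {α : Type*} [Preorder α] {x y : α} (h : x ≤ y) :
    @IsPreconnected α (lowerTop α) {x, y} := by
  letI := lowerTop α
  refine IsPreconnected.subset_closure (s := {x}) isPreconnected_singleton (by simp) ?_
  rintro z (rfl | rfl)
  · exact subset_closure rfl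
  · rw [mem_closure_iff]
    intro o ho hz
    exact ⟨x, (show IsLowerSet o from ho) h hz, rfl⟩

theorem aux_mem {α : Type*} [Preorder α] {S : Set α} {x y z : α} (h : x ≤ y ∨ y ≤ x)
    (hx : x ∈ @connectedComponentIn α (lowerTop α) S z) (hy : y ∈ S) :
    y ∈ @connectedComponentIn α (lowerTop α) S z := by
  letI := lowerTop α
  have hxS : x ∈ S := connectedComponentIn_subset S z hx
  rw [connectedComponentIn_eq hx]
  have hp : IsPreconnected ({x, y} : Set α) := by
    rcases h with h | h
    · exact aux_pre h
    · rw [Set.pair_comm]; exact aux_pre h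
  exact hp.subset_connectedComponentIn (by simp) (by rintro w (rfl | rfl) <;> assumption) (by simp)

theorem aux_U {α : Type*} [PartialOrder α] (h : ∃ m : α, IsTop m) : scrU α = {univ} := by
  obtain ⟨m, hm⟩ := h
  have key : ∀ x : α, @connectedComponentIn α (lowerTop α) univ x = univ := by
    intro x
    letI := lowerTop α
    refine eq_univ_of_forall fun y => ?_
    have h1 : x ∈ connectedComponentIn univ x := mem_connectedComponentIn (mem_univ x)
    exact aux_mem (Or.inr (hm y)) (aux_mem (Or.inl (hm x)) h1 (mem_univ m)) (mem_univ y)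
  ext C
  constructor
  · rintro ⟨A, -, hmax, x, -, rfl⟩
    have : UA A = univ := by
      refine eq_univ_of_forall fun y => ?_
      simp only [UA, mem_iInter, mem_Iic]
      exact fun a ha => (hm y).trans (hmax a ha (hm a))
    rw [this]; exact key x
  · rintro rfl
    have : UA {m} = univ := by
      refine eq_univ_of_forall fun y => ?_
      simpa [UA] using hm y
    refine ⟨{m}, ⟨m, rfl⟩, ?_, m, ?_, ?_⟩
    · rintro a rfl
      exact hm.isMax
    · rw [this]; trivial
    · rw [this]; exact (key m).symm

theorem aux_F {α : Type*} [PartialOrder α] (h : ∃ m : α, IsBot m) : scrF α = {univ} := by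
  obtain ⟨m, hm⟩ := h
  have key : ∀ x : α, @connectedComponentIn α (lowerTop α) univ x = univ := by
    intro x
    letI := lowerTop α
    refine eq_univ_of_forall fun y => ?_
    have h1 : x ∈ connectedComponentIn univ x := mem_connectedComponentIn (mem_univ x)
    exact aux_mem (Or.inl (hm y)) (aux_mem (Or.inr (hm x)) h1 (mem_univ m)) (mem_univ y)
  ext C
  constructor
  · rintro ⟨A, -, hmin, x, -, rfl⟩
    have : FA A = univ := by
      refine eq_univ_of_forall fun y => ?_
      simp only [FA, mem_iInter, mem_Ici]
      exact fun a ha => (hmin a ha (hm a)).trans (hm y)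
    rw [this]; exact key x
  · rintro rfl
    have : FA {m} = univ := by
      refine eq_univ_of_forall fun y => ?_
      simpa [FA] using hm y
    refine ⟨{m}, ⟨m, rfl⟩, ?_, m, ?_, ?_⟩
    · rintro a rfl
      exact hm.isMin
    · rw [this]; trivial
    · rw [this]; exact (key m).symm

/-- if `X` is connected and `𝒰(X) ∩ ℱ(X) ≠ ∅` then `X` has a maximum and a
minimum and `𝒰(X) = ℱ(X) = {X}`; moreover (for any `X`) a maximum gives `𝒰(X) = {X}` and a
minimum gives `ℱ(X) = {X}`. -/
theorem stmt2 {α : Type*} [PartialOrder α] [Fintype α] :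
    (PosetConnected α → (scrU α ∩ scrF α).Nonempty →
      (∃ m : α, IsTop m) ∧ (∃ m : α, IsBot m) ∧
        scrU α = {univ} ∧ scrF α = {univ}) ∧
    ((∃ m : α, IsTop m) → scrU α = {univ}) ∧
    ((∃ m : α, IsBot m) → scrF α = {univ}) := by
  refine ⟨?_, aux_U, aux_F⟩
  rintro hc ⟨C, ⟨A, ⟨a, ha⟩, -, x, hx, hCx⟩, ⟨B, ⟨b, hb⟩, -, y, hy, hCy⟩⟩
  letI := lowerTop α
  haveI : ConnectedSpace α := hc
  have hCA : C ⊆ UA A := hCx ▸ connectedComponentIn_subset _ _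
  have hCB : C ⊆ FA B := hCy ▸ connectedComponentIn_subset _ _
  have hlow : IsLowerSet C := by
    intro u v hvu hu
    have hvA : v ∈ UA A := by
      have := hCA hu
      simp only [UA, mem_iInter, mem_Iic] at this ⊢
      exact fun a ha => hvu.trans (this a ha)
    rw [hCx] at hu ⊢
    exact aux_mem (Or.inr hvu) hu hvA
  have hup : IsUpperSet C := by
    intro u v huv hu
    have hvB : v ∈ FA B := by
      have := hCB hu
      simp only [FA, mem_iInter, mem_Ici] at this ⊢
      exact fun a ha => (this a ha).trans huv
    rw [hCy] at hu ⊢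
    exact aux_mem (Or.inl huv) hu hvB
  have hclopen : IsClopen C := by
    refine ⟨⟨?_⟩, hlow⟩
    exact hup.compl
  have hne : C.Nonempty := ⟨x, by rw [hCx]; exact mem_connectedComponentIn hx⟩
  have hun : C = univ := hclopen.eq_univ hne
  have htop : ∃ m : α, IsTop m := ⟨a, fun z => by
    have := hCA (hun ▸ mem_univ z)
    simp only [UA, mem_iInter, mem_Iic] at this
    exact this a ha⟩
  have hbot : ∃ m : α, IsBot m := ⟨b, fun z => by
    have := hCB (hun ▸ mem_univ z)
    simp only [FA, mem_iInter, mem_Ici] at this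
    exact this b hb⟩
  exact ⟨htop, hbot, aux_U htop, aux_F hbot⟩
end

section
/- Let X be a finite T₀-space. Then the maximal elements of the poset 𝒞(X) are exactly the sets U_a with a a maximal element of X, and the minimal elements of 𝒞(X) are exactly the sets F_a with a a minimal element of X. -/
open Set

theorem preconn_Iic {α : Type*} [PartialOrder α] (x : α) :
    @IsPreconnected α (lowerTop α) (Iic x) := by
  rintro u v hu hv hc ⟨p, hp, hpu⟩ ⟨q, hq, hqv⟩
  have hu' : IsLowerSet u := hu
  have hv' : IsLowerSet v := hv
  rcases hc (show x ∈ Iic x from le_rfl) with h | h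
  · exact ⟨q, hq, hu' hq h, hqv⟩
  · exact ⟨p, hp, hpu, hv' hp h⟩

theorem preconn_Ici {α : Type*} [PartialOrder α] (x : α) :
    @IsPreconnected α (lowerTop α) (Ici x) := by
  rintro u v hu hv hc ⟨p, hp, hpu⟩ ⟨q, hq, hqv⟩
  have hu' : IsLowerSet u := hu
  have hv' : IsLowerSet v := hv
  exact ⟨x, le_rfl, hu' hp hpu, hv' hq hqv⟩

theorem mem_CC_iff_Iic {α : Type*} [PartialOrder α] (a : α) (C : Set α) :
    C ∈ CC (Iic a) ↔ C = Iic a := by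
  letI := lowerTop α
  have key : ∀ x ∈ Iic a, connectedComponentIn (Iic a) x = Iic a := fun x hx =>
    (connectedComponentIn_subset _ _).antisymm
      ((preconn_Iic a).subset_connectedComponentIn hx subset_rfl)
  constructor
  · rintro ⟨x, hx, rfl⟩
    exact key x hx
  · rintro rfl
    exact ⟨a, le_rfl, (key a le_rfl).symm⟩

theorem mem_CC_iff_Ici {α : Type*} [PartialOrder α] (a : α) (C : Set α) :
    C ∈ CC (Ici a) ↔ C = Ici a := by
  letI := lowerTop α
  have key : ∀ x ∈ Ici a, connectedComponentIn (Ici a) x = Ici a := fun x hx =>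
    (connectedComponentIn_subset _ _).antisymm
      ((preconn_Ici a).subset_connectedComponentIn hx subset_rfl)
  constructor
  · rintro ⟨x, hx, rfl⟩
    exact key x hx
  · rintro rfl
    exact ⟨a, le_rfl, (key a le_rfl).symm⟩

theorem Iic_mem_scrU {α : Type*} [PartialOrder α] {a : α} (ha : IsMax a) :
    Iic a ∈ scrU α := by
  refine ⟨{a}, singleton_nonempty a, by simpa using ha, ?_⟩
  have : UA {a} = Iic a := by simp [UA]
  rw [this, mem_CC_iff_Iic]

theorem Ici_mem_scrF {α : Type*} [PartialOrder α] {a : α} (ha : IsMin a) :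
    Ici a ∈ scrF α := by
  refine ⟨{a}, singleton_nonempty a, by simpa using ha, ?_⟩
  have : FA {a} = Ici a := by simp [FA]
  rw [this, mem_CC_iff_Ici]

theorem scrU_facts {α : Type*} [PartialOrder α] {C : Set α} (h : C ∈ scrU α) :
    C.Nonempty ∧ IsLowerSet C ∧ (∃ a, IsMax a ∧ C ⊆ Iic a) ∧
    ∀ b, (∀ b', IsMax b' → C ⊆ Iic b' → b' = b) → C = Iic b := by
  letI := lowerTop α
  obtain ⟨A, ⟨a, ha⟩, hA, hC⟩ := h
  have hC0 := hC
  obtain ⟨x, hx, rfl⟩ := hC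
  have hsub : ∀ a ∈ A, connectedComponentIn (UA A) x ⊆ Iic a := fun a ha =>
    (connectedComponentIn_subset _ _).trans (biInter_subset_of_mem ha)
  refine ⟨⟨x, mem_connectedComponentIn hx⟩, ?_, ⟨a, hA a ha, hsub a ha⟩, ?_⟩
  · intro p q hqp hp
    have hpS : p ∈ UA A := connectedComponentIn_subset _ _ hp
    rw [connectedComponentIn_eq hp]
    refine (preconn_Iic p).subset_connectedComponentIn (le_refl p) ?_ hqp
    intro y hy
    simp only [UA, mem_iInter, mem_Iic] at hpS ⊢
    exact fun i hi => le_trans hy (hpS i hi)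
  · intro b hb
    have : A = {b} := by
      ext c
      constructor
      · intro hc; exact hb c (hA c hc) (hsub c hc)
      · rintro rfl; rwa [← hb a (hA a ha) (hsub a ha)]
    subst this
    have h2 : UA {b} = Iic b := by simp [UA]
    rw [← mem_CC_iff_Iic, ← h2]
    exact hC0

theorem scrF_facts {α : Type*} [PartialOrder α] {C : Set α} (h : C ∈ scrF α) :
    C.Nonempty ∧ IsUpperSet C ∧ (∃ a, IsMin a ∧ C ⊆ Ici a) ∧
    ∀ b, (∀ b', IsMin b' → C ⊆ Ici b' → b' = b) → C = Ici b := by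
  letI := lowerTop α
  obtain ⟨A, ⟨a, ha⟩, hA, hC⟩ := h
  have hC0 := hC
  obtain ⟨x, hx, rfl⟩ := hC
  have hsub : ∀ a ∈ A, connectedComponentIn (FA A) x ⊆ Ici a := fun a ha =>
    (connectedComponentIn_subset _ _).trans (biInter_subset_of_mem ha)
  refine ⟨⟨x, mem_connectedComponentIn hx⟩, ?_, ⟨a, hA a ha, hsub a ha⟩, ?_⟩
  · intro p q hqp hp
    have hpS : p ∈ FA A := connectedComponentIn_subset _ _ hp
    rw [connectedComponentIn_eq hp]
    refine (preconn_Ici p).subset_connectedComponentIn (le_refl p) ?_ hqp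
    intro y hy
    simp only [FA, mem_iInter, mem_Ici] at hpS ⊢
    exact fun i hi => le_trans (hpS i hi) hy
  · intro b hb
    have : A = {b} := by
      ext c
      constructor
      · intro hc; exact hb c (hA c hc) (hsub c hc)
      · rintro rfl; rwa [← hb a (hA a ha) (hsub a ha)]
    subst this
    have h2 : FA {b} = Ici b := by simp [FA]
    rw [← mem_CC_iff_Ici, ← h2]
    exact hC0

/-- the maximal elements of the poset `𝒞(X)` are exactly the `U_a` with `a`
maximal in `X`, and the minimal elements of `𝒞(X)` are exactly the `F_a` with `a` minimal. -/
theorem stmt3 {α : Type*} [PartialOrder α] [Fintype α] :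
    ({C | C ∈ scrC α ∧ ∀ D ∈ scrC α, cleq α C D → D = C} =
      {C : Set α | ∃ a : α, IsMax a ∧ C = Iic a}) ∧
    ({C | C ∈ scrC α ∧ ∀ D ∈ scrC α, cleq α D C → D = C} =
      {C : Set α | ∃ a : α, IsMin a ∧ C = Ici a}) := by
  constructor
  · ext C
    constructor
    · rintro ⟨hC | hC, hm⟩
      · obtain ⟨-, -, ⟨a, ha, hs⟩, -⟩ := scrU_facts hC
        exact ⟨a, ha, (hm _ (Or.inl (Iic_mem_scrU ha)) (Or.inl ⟨hC, Iic_mem_scrU ha, hs⟩)).symm⟩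
      · obtain ⟨⟨x, hx⟩, -, -, -⟩ := scrF_facts hC
        obtain ⟨a, hxa, ha⟩ := (Set.toFinite (univ : Set α)).exists_le_maximal (mem_univ x)
        have ha : IsMax a := fun b hb => ha.2 (mem_univ b) hb
        exact ⟨a, ha, (hm _ (Or.inl (Iic_mem_scrU ha))
          (Or.inr (Or.inr ⟨hC, Iic_mem_scrU ha, x, hx, hxa⟩))).symm⟩
    · rintro ⟨a, ha, rfl⟩
      refine ⟨Or.inl (Iic_mem_scrU ha), ?_⟩
      rintro D - (⟨-, hD, h⟩ | ⟨hC, hD, h⟩ | ⟨hC, hD, x, hx, hxD⟩)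
      · obtain ⟨-, -, -, h4⟩ := scrU_facts hD
        exact h4 a fun b hb hDb => (ha.eq_of_le (hDb (h le_rfl))).symm
      · obtain ⟨-, hup, ⟨b, hb, hCb⟩, h4'⟩ := scrF_facts hC
        obtain ⟨⟨x, hx⟩, hupD, -, h4⟩ := scrF_facts hD
        have key : ∀ b', IsMin b' → b' ≤ a → b' = b := fun b' hb' h' =>
          (hb'.eq_of_ge (hCb h'))
        rw [h4 b fun b' hb' hDb => key b' hb' (hDb (hupD (h hx) hx)),
          h4' b fun b' hb' hDb => key b' hb' (hDb le_rfl)]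
      · obtain ⟨-, hup, -, -⟩ := scrF_facts hC
        obtain ⟨-, -, -, h4⟩ := scrU_facts hD
        exact h4 a fun b hb hDb => hb.eq_of_le (hup (hDb hxD) hx)
  · ext C
    constructor
    · rintro ⟨hC | hC, hm⟩
      · obtain ⟨⟨x, hx⟩, -, -, -⟩ := scrU_facts hC
        obtain ⟨a, hxa, ha⟩ := (Set.toFinite (univ : Set α)).exists_le_minimal (mem_univ x)
        have ha : IsMin a := fun b hb => ha.2 (mem_univ b) hb
        exact ⟨a, ha, (hm _ (Or.inr (Ici_mem_scrF ha))
          (Or.inr (Or.inr ⟨Ici_mem_scrF ha, hC, x, hxa, hx⟩))).symm⟩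
      · obtain ⟨-, -, ⟨a, ha, hs⟩, -⟩ := scrF_facts hC
        exact ⟨a, ha, (hm _ (Or.inr (Ici_mem_scrF ha))
          (Or.inr (Or.inl ⟨Ici_mem_scrF ha, hC, hs⟩))).symm⟩
    · rintro ⟨a, ha, rfl⟩
      refine ⟨Or.inr (Ici_mem_scrF ha), ?_⟩
      rintro D - (⟨hD, hC, h⟩ | ⟨hD, -, h⟩ | ⟨hD, hC, x, hxD, hx⟩)
      · obtain ⟨-, hup, ⟨b, hb, hCb⟩, h4'⟩ := scrU_facts hC
        obtain ⟨⟨x, hx⟩, hupD, -, h4⟩ := scrU_facts hD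
        have key : ∀ b', IsMax b' → a ≤ b' → b' = b := fun b' hb' h' =>
          (hb'.eq_of_le (hCb h'))
        rw [h4 b fun b' hb' hDb => key b' hb' (hDb (hupD (h hx) hx)),
          h4' b fun b' hb' hDb => key b' hb' (hDb le_rfl)]
      · obtain ⟨-, -, -, h4⟩ := scrF_facts hD
        exact h4 a fun b hb hDb => (ha.eq_of_ge (hDb (h le_rfl))).symm
      · obtain ⟨-, hup, -, -⟩ := scrU_facts hC
        obtain ⟨-, -, -, h4⟩ := scrF_facts hD
        exact h4 a fun b hb hDb => hb.eq_of_ge (hup (hDb hxD) hx)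
end

section
/- Let X be a finite T₀-space. Then 𝒰(X) is a basis for a topology on X which is coarser than the topology of X. That is: every element of 𝒰(X) is open in X, the union of the elements of 𝒰(X) is X, and for all C₁, C₂ ∈ 𝒰(X) and every x ∈ C₁ ∩ C₂ there exists C ∈ 𝒰(X) with x ∈ C ⊆ C₁ ∩ C₂. -/
open Set

theorem aux_lower {α : Type*} [Preorder α] {S : Set α} (hS : IsLowerSet S) (x : α) :
    letI := lowerTop α
    IsLowerSet (connectedComponentIn S x) := by
  letI := lowerTop α
  intro y z hzy hy
  have hyS : y ∈ S := connectedComponentIn_subset S x hy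
  have hpre : IsPreconnected (Iic y) := by
    rintro u v hu hv huv ⟨a, ha, hau⟩ ⟨b, hb, hbv⟩
    have hu' : IsLowerSet u := hu
    have hv' : IsLowerSet v := hv
    rcases huv (mem_Iic.2 le_rfl) with h | h
    · exact ⟨b, hb, hu' hb h, hbv⟩
    · exact ⟨a, ha, hau, hv' ha h⟩
  have hsub : Iic y ⊆ S := fun w hw => hS hw hyS
  rw [connectedComponentIn_eq hy]
  exact hpre.subset_connectedComponentIn (mem_Iic.2 le_rfl) hsub hzy

theorem aux_UA {α : Type*} [Preorder α] (A : Set α) : IsLowerSet (UA A) :=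
  isLowerSet_iInter₂ fun a _ => isLowerSet_Iic a

/-- `𝒰(X)` is a basis for a topology on `X` coarser than that of `X`: its
elements are open (i.e. lower sets), they cover `X`, and any point of an intersection of two
of them lies in a third one contained in the intersection. -/
theorem stmt6 {α : Type*} [PartialOrder α] [Fintype α] :
    (∀ C ∈ scrU α, IsLowerSet C) ∧
    (⋃₀ scrU α = univ) ∧
    (∀ C₁ ∈ scrU α, ∀ C₂ ∈ scrU α, ∀ x ∈ C₁ ∩ C₂,
      ∃ C ∈ scrU α, x ∈ C ∧ C ⊆ C₁ ∩ C₂) := by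
  letI := lowerTop α
  refine ⟨?_, ?_, ?_⟩
  · rintro C ⟨A, -, -, x, -, rfl⟩
    exact aux_lower (aux_UA A) x
  · refine eq_univ_of_forall fun x => ?_
    obtain ⟨m, hxm, hm⟩ := Finite.exists_le_maximal (p := fun _ : α => True) (a := x) trivial
    have hx : x ∈ UA {m} := by simpa [UA] using hxm
    refine ⟨connectedComponentIn (UA {m}) x, ⟨{m}, singleton_nonempty m, ?_, x, hx, rfl⟩,
      mem_connectedComponentIn hx⟩
    rintro a rfl
    exact fun b hb => hm.2 trivial hb
  · rintro C₁ ⟨A, hA, hAm, y, -, rfl⟩ C₂ ⟨B, hB, hBm, z, -, rfl⟩ x ⟨h1, h2⟩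
    have hxA := connectedComponentIn_subset _ _ h1
    have hxB := connectedComponentIn_subset _ _ h2
    have hU : UA (A ∪ B) = UA A ∩ UA B := by simp only [UA, biInter_union]
    have hx : x ∈ UA (A ∪ B) := by rw [hU]; exact ⟨hxA, hxB⟩
    refine ⟨connectedComponentIn (UA (A ∪ B)) x, ⟨A ∪ B, hA.inl, ?_, x, hx, rfl⟩,
      mem_connectedComponentIn hx, ?_⟩
    · rintro a (h | h)
      exacts [hAm a h, hBm a h]
    · rw [connectedComponentIn_eq h1, connectedComponentIn_eq h2, hU]
      exact subset_inter (connectedComponentIn_mono _ inter_subset_left)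
        (connectedComponentIn_mono _ inter_subset_right)
end

section
/- Let X be a finite T₀-space and let f : X → X be a continuous map. (a) If C ∈ 𝒰(X) is a subspace of X with the fixed point property and 𝒰(f)(C) ⊆ C, then f has a fixed point. (b) If C ∈ ℱ(X) is a subspace of X with the fixed point property and ℱ(f)(C) ⊆ C, then f has a fixed point. -/
open Set

/-- if `C ∈ 𝒰(X)` has the fixed point property and `𝒰(f)(C) ⊆ C` then `f` has
a fixed point; dually for `C ∈ ℱ(X)` with `ℱ(f)(C) ⊆ C`. -/
theorem stmt11 {α : Type*} [PartialOrder α] [Fintype α] (f : α → α) (hf : Monotone f) :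
    (∀ C ∈ scrU α, SubFPP C → ∀ D, UImage f C D → D ⊆ C → ∃ x, f x = x) ∧
    (∀ C ∈ scrF α, SubFPP C → ∀ D, FImage f C D → D ⊆ C → ∃ x, f x = x) := by
  have key : ∀ C : Set α, SubFPP C → (∀ x ∈ C, f x ∈ C) → ∃ x, f x = x := by
    intro C hC hm
    letI := lowerTop α
    have hfc : Continuous f := ⟨fun s hs => IsLowerSet.preimage (s := s) hs hf⟩
    obtain ⟨x, hx⟩ := hC (fun x => ⟨f x, hm x x.2⟩)
      ((hfc.comp continuous_subtype_val).subtype_mk _)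
    exact ⟨x, congrArg Subtype.val hx⟩
  exact ⟨fun C _ hC D hD hDC => key C hC fun x hx => hDC (hD.2.1 (mem_image_of_mem f hx)),
    fun C _ hC D hD hDC => key C hC fun x hx => hDC (hD.2.1 (mem_image_of_mem f hx))⟩
end

section
/- Let X be a finite T₀-space. If the finite poset 𝒰(X) (ordered by inclusion, regarded as a finite T₀-space) has the fixed point property and every C ∈ 𝒰(X), regarded as a subspace of X, has the fixed point property, then X has the fixed point property. The same conclusion holds with ℱ(X) (ordered by reverse inclusion) in place of 𝒰(X). -/
open Set

theorem aux_mono {α β : Type*} [Preorder α] [Preorder β] (f : α → β) :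
    @Continuous _ _ (lowerTop α) (lowerTop β) f ↔ Monotone f := by
  letI := lowerTop α
  letI := lowerTop β
  constructor
  · intro h x y hxy
    have h1 : IsLowerSet (f ⁻¹' (Iic (f y))) := h.isOpen_preimage (Iic (f y)) (isLowerSet_Iic (f y))
    exact h1 hxy (le_refl (f y))
  · intro h
    refine continuous_def.2 fun s hs => ?_
    have hs' : IsLowerSet s := hs
    have : IsLowerSet (f ⁻¹' s) := fun a b hba ha => hs' (h hba) ha
    exact this

theorem aux_min {α : Type*} [TopologicalSpace α] (P : α → Prop) (K : α → Set α) (B : Set α)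
    (hB : IsConnected B) (hK : ∃ a, P a ∧ B ⊆ K a) :
    ∃ D : Set α, (∃ A : Set α, A.Nonempty ∧ (∀ a ∈ A, P a) ∧
        ∃ x ∈ ⋂ a ∈ A, K a, D = connectedComponentIn (⋂ a ∈ A, K a) x) ∧ B ⊆ D ∧
      ∀ D', (∃ A : Set α, A.Nonempty ∧ (∀ a ∈ A, P a) ∧
        ∃ x ∈ ⋂ a ∈ A, K a, D' = connectedComponentIn (⋂ a ∈ A, K a) x) → B ⊆ D' → D ⊆ D' := by
  obtain ⟨a, ha, hBa⟩ := hK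
  obtain ⟨x, hx⟩ := hB.nonempty
  have hsub : B ⊆ ⋂ b ∈ {b | P b ∧ B ⊆ K b}, K b := subset_iInter₂ fun b hb => hb.2
  refine ⟨connectedComponentIn (⋂ b ∈ {b | P b ∧ B ⊆ K b}, K b) x,
    ⟨{b | P b ∧ B ⊆ K b}, ⟨a, ha, hBa⟩, fun b hb => hb.1, x, hsub hx, rfl⟩,
    hB.isPreconnected.subset_connectedComponentIn hx hsub, ?_⟩
  rintro D' ⟨A, -, hA, y, hy, rfl⟩ hBD
  have e := connectedComponentIn_eq (hBD hx)
  rw [e]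
  refine connectedComponentIn_mono x ?_
  refine subset_iInter₂ fun b hb => ?_
  refine biInter_subset_of_mem (show b ∈ {b | P b ∧ B ⊆ K b} from ⟨hA b hb, ?_⟩)
  exact (hBD.trans (connectedComponentIn_subset _ _)).trans (biInter_subset_of_mem hb)

theorem aux_fix {α : Type*} [TopologicalSpace α] (f : α → α) (hf : Continuous f) (C : Set α)
    (hC : HasFPP C) (h : f '' C ⊆ C) : ∃ x, f x = x := by
  have hm : MapsTo f C C := fun x hx => h ⟨x, hx, rfl⟩
  obtain ⟨x, hx⟩ := hC (hm.restrict f C C) (hf.restrict hm)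
  exact ⟨x, congrArg Subtype.val hx⟩

/-- if the poset `𝒰(X)` (ordered by inclusion) has the fixed point property and
every `C ∈ 𝒰(X)` has it as a subspace of `X`, then `X` has the fixed point property; the same
with `ℱ(X)` (ordered by reverse inclusion). -/
theorem stmt12 {α : Type*} [PartialOrder α] [Fintype α] :
    ((PosetFPP (↥(scrU α)) → (∀ C ∈ scrU α, SubFPP C) → PosetFPP α)) ∧
    ((PosetFPP (↥(scrF α))ᵒᵈ → (∀ C ∈ scrF α, SubFPP C) → PosetFPP α)) := by
  letI := lowerTop α
  constructor
  · intro hU hC f hf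
    have hm := (aux_mono f).1 hf
    have key : ∀ C : scrU α, ∃ D : scrU α, f '' C.1 ⊆ D.1 ∧
        ∀ D' : scrU α, f '' C.1 ⊆ D'.1 → D ≤ D' := by
      rintro ⟨C, A, ⟨a, ha⟩, hA, x, hx, rfl⟩
      have hcon : IsConnected (connectedComponentIn (UA A) x) :=
        isConnected_connectedComponentIn_iff.2 hx
      obtain ⟨b, hb, hbm⟩ := (Set.toFinite (univ : Set α)).exists_le_maximal (mem_univ (f a))
      obtain ⟨D, hD, h1, h2⟩ := aux_min (fun a : α => IsMax a) (fun a => Iic a) _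
        (hcon.image f hf.continuousOn) ⟨b, fun c hc => hbm.2 (mem_univ c) hc, by
          rintro _ ⟨y, hy, rfl⟩
          have hy' := connectedComponentIn_subset _ _ hy
          exact (hm (mem_iInter₂.1 hy' a ha)).trans hb⟩
      exact ⟨⟨D, hD⟩, h1, fun D' h => h2 D'.1 D'.2 h⟩
    choose g hg1 hg2 using key
    obtain ⟨C, hfix⟩ := hU g ((aux_mono g).2 fun C C' h =>
      hg2 C (g C') ((image_mono h).trans (hg1 C')))
    have := hg1 C
    rw [hfix] at this
    exact aux_fix f hf C.1 (hC C.1 C.2) this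
  · intro hU hC f hf
    have hm := (aux_mono f).1 hf
    have key : ∀ C : scrF α, ∃ D : scrF α, f '' C.1 ⊆ D.1 ∧
        ∀ D' : scrF α, f '' C.1 ⊆ D'.1 → D ≤ D' := by
      rintro ⟨C, A, ⟨a, ha⟩, hA, x, hx, rfl⟩
      have hcon : IsConnected (connectedComponentIn (FA A) x) :=
        isConnected_connectedComponentIn_iff.2 hx
      obtain ⟨b, hb, hbm⟩ := (Set.toFinite (univ : Set α)).exists_le_minimal (mem_univ (f a))
      obtain ⟨D, hD, h1, h2⟩ := aux_min (fun a : α => IsMin a) (fun a => Ici a) _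
        (hcon.image f hf.continuousOn) ⟨b, fun c hc => hbm.2 (mem_univ c) hc, by
          rintro _ ⟨y, hy, rfl⟩
          have hy' := connectedComponentIn_subset _ _ hy
          exact hb.trans (hm (mem_iInter₂.1 hy' a ha))⟩
      exact ⟨⟨D, hD⟩, h1, fun D' h => h2 D'.1 D'.2 h⟩
    choose g hg1 hg2 using key
    have hgm : Monotone g := fun C C' h => hg2 C (g C') ((image_mono h).trans (hg1 C'))
    obtain ⟨C, hfix⟩ := hU (fun C => OrderDual.toDual (g (OrderDual.ofDual C)))
      ((aux_mono _).2 hgm.dual)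
    have := hg1 (OrderDual.ofDual C)
    have hfix' : g (OrderDual.ofDual C) = OrderDual.ofDual C := hfix
    rw [hfix'] at this
    exact aux_fix f hf _ (hC _ (OrderDual.ofDual C).2) this
end

section
/- Let X be a finite T₀-space, let A be a bp-retract of X and let r : X → A be the corresponding retraction. Then: (a) for every C ∈ 𝒰(X) ∪ ℱ(X), r(C) = C ∩ A; (b) if every maximal element of X lies in A and C ∈ 𝒰(X), then C ∩ A ∈ 𝒰(A); (c) if every minimal element of X lies in A and C ∈ ℱ(X), then C ∩ A ∈ ℱ(A). -/
open Set

theorem lt_cont {α β : Type*} [Preorder α] [Preorder β] (f : α → β) (hf : Monotone f) :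
    @Continuous α β (lowerTop α) (lowerTop β) f := by
  letI := lowerTop α
  letI := lowerTop β
  refine ⟨fun s hs => ?_⟩
  intro a b hab ha
  exact (show IsLowerSet s from hs) (hf hab) ha

theorem lt_pair {α : Type*} [Preorder α] (x y : α) (h : x ≤ y) :
    @IsPreconnected α (lowerTop α) {x, y} := by
  letI := lowerTop α
  refine IsPreconnected.subset_closure (s := {x}) isPreconnected_singleton (by simp) ?_
  rintro z (rfl | rfl)
  · exact subset_closure rfl
  · rw [mem_closure_iff]
    intro o ho hz
    exact ⟨x, (show IsLowerSet o from ho) h hz, rfl⟩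

theorem lt_rmem {α : Type*} [Preorder α] (r : α → α)
    (hbp : (∀ x, r x ≤ x) ∨ (∀ x, x ≤ r x)) (S : Set α) (hS : ∀ x ∈ S, r x ∈ S)
    (C : Set α) (hC : C ∈ CC S) (x : α) (hx : x ∈ C) : r x ∈ C := by
  letI := lowerTop α
  obtain ⟨x0, hx0, rfl⟩ := hC
  have hxS : x ∈ S := connectedComponentIn_subset _ _ hx
  rw [connectedComponentIn_eq hx]
  have hp : IsPreconnected ({x, r x} : Set α) := by
    rcases hbp with h | h
    · rw [Set.pair_comm]; exact lt_pair _ _ (h x)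
    · exact lt_pair _ _ (h x)
  refine hp.subset_connectedComponentIn (by simp) ?_ (by simp)
  rintro z (rfl | rfl)
  · exact hxS
  · exact hS _ hxS

theorem lt_cc {α : Type*} [Preorder α] (A : Set α) (r : α → α)
    (hmono : Monotone r) (hran : ∀ x, r x ∈ A) (hretr : ∀ a ∈ A, r a = a)
    (hbp : (∀ x, r x ≤ x) ∨ (∀ x, x ≤ r x)) (S : Set α) (hS : ∀ x ∈ S, r x ∈ S)
    (C : Set α) (hC : C ∈ CC S) :
    (Subtype.val ⁻¹' C : Set ↥A) ∈ CC (Subtype.val ⁻¹' S : Set ↥A) := by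
  have hr := lt_rmem r hbp S hS C hC
  letI t1 := lowerTop α
  letI t2 := lowerTop ↥A
  obtain ⟨x0, hx0, rfl⟩ := hC
  have hrx : r x0 ∈ connectedComponentIn S x0 := hr _ (mem_connectedComponentIn hx0)
  refine ⟨⟨r x0, hran _⟩, hS _ hx0, ?_⟩
  let q : α → ↥A := fun x => ⟨r x, hran x⟩
  have hq : Continuous q := lt_cont q (fun a b h => hmono h)
  have hv : @Continuous ↥A α t2 t1 Subtype.val := lt_cont _ (fun a b h => h)
  have himg : (Subtype.val ⁻¹' (connectedComponentIn S x0) : Set ↥A)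
      = q '' connectedComponentIn S x0 := by
    ext ⟨a, ha⟩
    constructor
    · intro h
      exact ⟨a, h, Subtype.ext (hretr a ha)⟩
    · rintro ⟨x, hx, hxa⟩
      have : r x = a := congrArg Subtype.val hxa
      show a ∈ connectedComponentIn S x0
      rw [← this]; exact hr x hx
  apply Set.Subset.antisymm
  · refine IsPreconnected.subset_connectedComponentIn ?_ hrx ?_
    · rw [himg]
      exact isPreconnected_connectedComponentIn.image q hq.continuousOn
    · exact Set.preimage_mono (connectedComponentIn_subset _ _)
  · rw [← Set.image_subset_iff, connectedComponentIn_eq hrx]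
    refine IsPreconnected.subset_connectedComponentIn ?_ ?_ ?_
    · exact isPreconnected_connectedComponentIn.image _ hv.continuousOn
    · exact ⟨⟨r x0, hran _⟩, mem_connectedComponentIn (hS _ hx0), rfl⟩
    · rw [Set.image_subset_iff]
      exact connectedComponentIn_subset _ _

theorem lt_U {α : Type*} [PartialOrder α] (r : α → α) (hmono : Monotone r)
    (hbp : (∀ x, r x ≤ x) ∨ (∀ x, x ≤ r x)) (B : Set α) (hB : ∀ a ∈ B, IsMax a) :
    ∀ x ∈ UA B, r x ∈ UA B := by
  intro x hx
  simp only [UA, Set.mem_iInter, Set.mem_Iic] at hx ⊢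
  intro b hb
  rcases hbp with h | h
  · exact (h x).trans (hx b hb)
  · exact (hmono (hx b hb)).trans (hB b hb (h b))

theorem lt_F {α : Type*} [PartialOrder α] (r : α → α) (hmono : Monotone r)
    (hbp : (∀ x, r x ≤ x) ∨ (∀ x, x ≤ r x)) (B : Set α) (hB : ∀ a ∈ B, IsMin a) :
    ∀ x ∈ FA B, r x ∈ FA B := by
  intro x hx
  simp only [FA, Set.mem_iInter, Set.mem_Ici] at hx ⊢
  intro b hb
  rcases hbp with h | h
  · exact (hB b hb (h b)).trans (hmono (hx b hb))
  · exact (hx b hb).trans (h x)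

/-- for a bp-retract `A` of `X` with retraction `r` (characterized as a monotone
idempotent self-retraction onto `A` which is pointwise `≤ id` or pointwise `≥ id`):
(a) `r(C) = C ∩ A` for every `C ∈ 𝒰(X) ∪ ℱ(X)`; (b) if all maximal elements of `X` lie in
`A` and `C ∈ 𝒰(X)` then `C ∩ A ∈ 𝒰(A)`; (c) dually with minimal elements and `ℱ`. -/
theorem stmt15 {α : Type*} [PartialOrder α] [Fintype α] (A : Set α) (r : α → α)
    (hmono : Monotone r) (hran : ∀ x, r x ∈ A) (hretr : ∀ a ∈ A, r a = a)
    (hbp : (∀ x, r x ≤ x) ∨ (∀ x, x ≤ r x)) :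
    (∀ C ∈ scrC α, r '' C = C ∩ A) ∧
    ((∀ a : α, IsMax a → a ∈ A) → ∀ C ∈ scrU α,
      (Subtype.val ⁻¹' C : Set ↥A) ∈ scrU ↥A) ∧
    ((∀ a : α, IsMin a → a ∈ A) → ∀ C ∈ scrF α,
      (Subtype.val ⁻¹' C : Set ↥A) ∈ scrF ↥A) := by
  have key : ∀ S : Set α, (∀ x ∈ S, r x ∈ S) → ∀ C ∈ CC S, r '' C = C ∩ A := by
    intro S hS C hC
    ext y
    constructor
    · rintro ⟨x, hx, rfl⟩
      exact ⟨lt_rmem r hbp S hS C hC x hx, hran x⟩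
    · rintro ⟨hy, hyA⟩
      exact ⟨y, hy, hretr y hyA⟩
  refine ⟨?_, ?_, ?_⟩
  · rintro C (⟨B, -, hB, hC⟩ | ⟨B, -, hB, hC⟩)
    · exact key _ (lt_U r hmono hbp B hB) C hC
    · exact key _ (lt_F r hmono hbp B hB) C hC
  · rintro hA C ⟨B, ⟨b, hb⟩, hB, hC⟩
    refine ⟨Subtype.val ⁻¹' B, ⟨⟨b, hA b (hB b hb)⟩, hb⟩, fun a ha c hc => hB a ha hc, ?_⟩
    have := lt_cc A r hmono hran hretr hbp _ (lt_U r hmono hbp B hB) C hC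
    convert this using 2
    ext ⟨x, hx⟩
    simp only [UA, Set.mem_iInter, Set.mem_Iic, Set.mem_preimage]
    exact ⟨fun h c hc => h ⟨c, hA c (hB c hc)⟩ hc, fun h c hc => h c hc⟩
  · rintro hA C ⟨B, ⟨b, hb⟩, hB, hC⟩
    refine ⟨Subtype.val ⁻¹' B, ⟨⟨b, hA b (hB b hb)⟩, hb⟩, fun a ha c hc => hB a ha hc, ?_⟩
    have := lt_cc A r hmono hran hretr hbp _ (lt_F r hmono hbp B hB) C hC
    convert this using 2
    ext ⟨x, hx⟩
    simp only [FA, Set.mem_iInter, Set.mem_Ici, Set.mem_preimage]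
    exact ⟨fun h c hc => h ⟨c, hA c (hB c hc)⟩ hc, fun h c hc => h c hc⟩
end

section
/- Let X be a finite T₀-space. Then the finite poset 𝒰(X) (ordered by inclusion) has no up beat points, and the finite poset ℱ(X) (ordered by reverse inclusion) has no down beat points. -/
open Set

theorem aux_Iic {α : Type*} [PartialOrder α] (a : α) :
    @IsPreconnected α (lowerTop α) (Iic a) := by
  letI := lowerTop α
  rintro u v hu hv hc ⟨x, hx, hxu⟩ ⟨y, hy, hyv⟩
  have hu' : IsLowerSet u := hu
  have hv' : IsLowerSet v := hv
  rcases hc (mem_Iic.2 le_rfl : a ∈ Iic a) with h | h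
  · exact ⟨y, hy, hu' hy h, hyv⟩
  · exact ⟨x, hx, hxu, hv' hx h⟩

theorem aux_Ici {α : Type*} [PartialOrder α] (a : α) :
    @IsPreconnected α (lowerTop α) (Ici a) := by
  letI := lowerTop α
  rintro u v hu hv hc ⟨x, hx, hxu⟩ ⟨y, hy, hyv⟩
  have hu' : IsLowerSet u := hu
  have hv' : IsLowerSet v := hv
  exact ⟨a, mem_Ici.2 le_rfl, hu' hx hxu, hv' hy hyv⟩

theorem aux_main {α : Type*} [TopologicalSpace α] (K : α → Set α) (M : α → Prop)
    (hK : ∀ a, IsPreconnected (K a)) (hs : ∀ a, a ∈ K a)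
    (hM : ∀ a b, M a → a ∈ K b → a = b) (S : Set (Set α))
    (hS : ∀ C, C ∈ S ↔ ∃ A : Set α, A.Nonempty ∧ (∀ a ∈ A, M a) ∧
      ∃ x ∈ ⋂ a ∈ A, K a, C = connectedComponentIn (⋂ a ∈ A, K a) x) :
    ∀ C ∈ S, ¬ ∃ D ∈ S, C ⊂ D ∧ ∀ E ∈ S, C ⊂ E → D ⊆ E := by
  rintro C hC ⟨D, hD, hCD, hmin⟩
  obtain ⟨A, -, hAM, x, hx, rfl⟩ := (hS C).1 hC
  obtain ⟨B, ⟨b, hb⟩, -, y, hy, rfl⟩ := (hS D).1 hD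
  have hxC := mem_connectedComponentIn hx
  have key : connectedComponentIn (⋂ a ∈ B, K a) y ⊆ ⋂ a ∈ A, K a := by
    refine subset_iInter₂ fun a ha => ?_
    have hE : K a ∈ S := (hS _).2 ⟨{a}, singleton_nonempty a, by
      rintro _ rfl; exact hAM _ ha, a, by simpa using hs a, by
      simpa using ((hK a).connectedComponentIn (hs a)).symm⟩
    have hsub : connectedComponentIn (⋂ a ∈ A, K a) x ⊆ K a :=
      (connectedComponentIn_subset _ _).trans (biInter_subset_of_mem ha)
    rcases hsub.eq_or_ssubset with h | h
    · have hDb : connectedComponentIn (⋂ a ∈ B, K a) y ⊆ K b :=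
        (connectedComponentIn_subset _ _).trans (biInter_subset_of_mem hb)
      have : a = b := hM a b (hAM a ha) (hDb (hCD.1 (h ▸ hs a)))
      rw [this]; exact hDb
    · exact hmin _ hE h
  exact hCD.2 (isPreconnected_connectedComponentIn.subset_connectedComponentIn (hCD.1 hxC) key)

/-- the poset `𝒰(X)` (ordered by `⊆`) has no up beat points, and the poset
`ℱ(X)` (ordered by `⊇`) has no down beat points. -/
theorem stmt17 {α : Type*} [PartialOrder α] [Fintype α] :
    (∀ C ∈ scrU α, ¬ ∃ D ∈ scrU α, C ⊂ D ∧ ∀ E ∈ scrU α, C ⊂ E → D ⊆ E) ∧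
    (∀ C ∈ scrF α, ¬ ∃ D ∈ scrF α, C ⊂ D ∧ ∀ E ∈ scrF α, C ⊂ E → D ⊆ E) := by
  letI := lowerTop α
  exact ⟨aux_main Iic IsMax aux_Iic (fun _ => le_rfl)
      (fun a b h hab => h.eq_of_le hab) (scrU α) (fun _ => Iff.rfl),
    aux_main Ici IsMin aux_Ici (fun _ => le_rfl)
      (fun a b h hab => h.eq_of_ge hab) (scrF α) (fun _ => Iff.rfl)⟩
end

section
/- Let X be a finite T₀-space and regard the poset 𝒰(X) (ordered by inclusion) as a finite T₀-space. Then every D ∈ 𝒰(𝒰(X)) has a maximum element, and the maps φ : 𝒰(𝒰(X)) → 𝒰(X) given by φ(D) = max D and ψ : 𝒰(X) → 𝒰(𝒰(X)) given by ψ(C) = {C' ∈ 𝒰(X) : C' ⊆ C} (the minimal open set of C in 𝒰(X)) are mutually inverse order isomorphisms. Consequently, 𝒰(𝒰(X)) is isomorphic to 𝒰(X). -/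
open Set

theorem aux_preconn {α : Type*} [Preorder α] (s : Set α) (M : α) (hM : IsGreatest s M) :
    @IsPreconnected α (lowerTop α) s := by
  intro u v hu hv huv hsu hsv
  have hu' : IsLowerSet u := hu
  have hv' : IsLowerSet v := hv
  obtain ⟨x, hxs, hxu⟩ := hsu
  obtain ⟨y, hys, hyv⟩ := hsv
  rcases huv hM.1 with h | h
  · exact ⟨y, hys, hu' (hM.2 hys) h, hyv⟩
  · exact ⟨x, hxs, hxu, hv' (hM.2 hxs) h⟩

theorem aux_mem_UA {α : Type*} [Preorder α] {A : Set α} {x : α} :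
    x ∈ UA A ↔ ∀ a ∈ A, x ≤ a := by
  simp [UA]

theorem aux_Iic_comp {α : Type*} [Preorder α] (S : Set α) (hS : IsLowerSet S) (M : α)
    (hM : M ∈ S) (hsep : ∀ x ∈ S, ∀ y, y ≤ x → y ≤ M → x ≤ M) (C : α) (hC : C ≤ M) :
    @connectedComponentIn α (lowerTop α) S C = Iic M := by
  letI := lowerTop α
  apply Subset.antisymm
  · have hv : IsLowerSet {x | x ∈ S ∧ ¬ x ≤ M} := fun x y hyx hx =>
      ⟨hS hyx hx.1, fun h => hx.2 (hsep x hx.1 y hyx h)⟩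
    have hu : IsLowerSet (Iic M) := isLowerSet_Iic M
    refine IsPreconnected.subset_left_of_subset_union (u := Iic M)
      (v := {x | x ∈ S ∧ ¬ x ≤ M}) hu hv ?_ ?_ ?_ isPreconnected_connectedComponentIn
    · rw [Set.disjoint_left]
      intro x hx hx'
      exact hx'.2 hx
    · intro x hx
      by_cases h : x ≤ M
      · exact Or.inl h
      · exact Or.inr ⟨connectedComponentIn_subset _ _ hx, h⟩
    · exact ⟨C, mem_connectedComponentIn (hS hC hM), hC⟩
  · exact IsPreconnected.subset_connectedComponentIn (aux_preconn _ M isGreatest_Iic) hC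
      (fun x hx => hS hx hM)

theorem aux_Iic_mem {α : Type*} [PartialOrder α] (a : α) (ha : IsMax a) : Iic a ∈ scrU α := by
  refine ⟨{a}, singleton_nonempty a, by simpa using ha, a, by simp [aux_mem_UA], ?_⟩
  refine (aux_Iic_comp _ ?_ a ?_ ?_ a le_rfl).symm
  · intro x y hyx hx
    rw [aux_mem_UA] at *
    exact fun b hb => hyx.trans (hx b hb)
  · simp [aux_mem_UA]
  · intro x hx y _ _
    exact aux_mem_UA.1 hx a rfl

theorem aux_conn {α : Type*} [PartialOrder α] {C : Set α} (hC : C ∈ scrU α) :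
    C.Nonempty ∧ @IsPreconnected α (lowerTop α) C ∧ ∃ a, IsMax a ∧ C ⊆ Iic a := by
  letI := lowerTop α
  obtain ⟨A, ⟨a, ha⟩, hA, x, hx, rfl⟩ := hC
  exact ⟨⟨x, mem_connectedComponentIn hx⟩, isPreconnected_connectedComponentIn, a, hA a ha,
    fun y hy => aux_mem_UA.1 (connectedComponentIn_subset _ _ hy) a ha⟩

theorem aux_max {α : Type*} [PartialOrder α] (C : ↥(scrU α)) :
    IsMax C ↔ ∃ a, IsMax a ∧ C.1 = Iic a := by
  constructor
  · intro h
    obtain ⟨_, _, a, ha, hs⟩ := aux_conn C.2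
    exact ⟨a, ha, Subset.antisymm hs (h (b := ⟨Iic a, aux_Iic_mem a ha⟩) hs)⟩
  · rintro ⟨a, ha, hCa⟩ D hD
    obtain ⟨_, _, b, hb, hs⟩ := aux_conn D.2
    have hD' : C.1 ⊆ D.1 := hD
    have hab : a ≤ b := hs (hD' (by rw [hCa]; exact le_rfl))
    have hba : b ≤ a := ha hab
    show D.1 ⊆ C.1
    rw [hCa]
    exact fun y hy => (hs hy).trans hba

theorem aux_key {α : Type*} [PartialOrder α] (A : Set α) (B : Set ↥(scrU α))
    (hB : ∀ C : ↥(scrU α), C ∈ UA B ↔ C.1 ⊆ UA A) (x : α) (hx : x ∈ UA A) (K : ↥(scrU α))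
    (hK : K.1 = @connectedComponentIn α (lowerTop α) (UA A) x) (C : ↥(scrU α)) (hC : C ≤ K) :
    @connectedComponentIn _ (lowerTop ↥(scrU α)) (UA B) C = Iic K := by
  letI := lowerTop α
  apply aux_Iic_comp _ _ _ _ _ _ hC
  · intro x y hyx hx
    rw [hB] at *
    exact Subset.trans hyx hx
  · rw [hB, hK]
    exact connectedComponentIn_subset _ _
  · intro P hP Q hQP hQK
    obtain ⟨⟨y, hy⟩, _⟩ := aux_conn Q.2
    have hyK : y ∈ K.1 := hQK hy
    have hyP : y ∈ P.1 := hQP hy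
    show P.1 ⊆ K.1
    rw [hK] at hyK ⊢
    rw [connectedComponentIn_eq hyK]
    exact (aux_conn P.2).2.1.subset_connectedComponentIn hyP ((hB P).1 hP)

theorem aux_main_s19 {α : Type*} [PartialOrder α] (D : Set ↥(scrU α)) :
    D ∈ scrU (↥(scrU α)) ↔ ∃ K, D = Iic K := by
  letI := lowerTop α
  constructor
  · rintro ⟨B, ⟨b, hb⟩, hBm, C, hC, rfl⟩
    let A : Set α := {a | IsMax a ∧ ∃ P ∈ B, P.1 = Iic a}
    have hB : ∀ C : ↥(scrU α), C ∈ UA B ↔ C.1 ⊆ UA A := by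
      intro C
      rw [aux_mem_UA]
      constructor
      · rintro h x hx
        rw [aux_mem_UA]
        rintro a ⟨ha, P, hP, hPa⟩
        have h1 : C.1 ⊆ P.1 := h P hP
        rw [hPa] at h1
        exact h1 hx
      · intro h P hP
        obtain ⟨a, ha, hPa⟩ := (aux_max P).1 (hBm P hP)
        show C.1 ⊆ P.1
        rw [hPa]
        exact fun y hy => aux_mem_UA.1 (h hy) a ⟨ha, P, hP, hPa⟩
    obtain ⟨⟨x, hx⟩, hpc, _⟩ := aux_conn C.2
    have hCA := (hB C).1 hC
    obtain ⟨a, ha, hba⟩ := (aux_max b).1 (hBm b hb)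
    exact ⟨⟨connectedComponentIn (UA A) x, A, ⟨a, ha, b, hb, hba⟩, fun a ha => ha.1, x, hCA hx,
      rfl⟩, aux_key A B hB x (hCA hx) _ rfl C (hpc.subset_connectedComponentIn hx hCA)⟩
  · rintro ⟨K, rfl⟩
    obtain ⟨A, ⟨a, ha⟩, hAm, x, hx, hKx⟩ := id K.2
    let B : Set ↥(scrU α) := {P | ∃ a ∈ A, P.1 = Iic a}
    have hB : ∀ C : ↥(scrU α), C ∈ UA B ↔ C.1 ⊆ UA A := by
      intro C
      rw [aux_mem_UA]
      constructor
      · rintro h x hx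
        rw [aux_mem_UA]
        intro a ha
        exact h ⟨Iic a, aux_Iic_mem a (hAm a ha)⟩ ⟨a, ha, rfl⟩ hx
      · rintro h P ⟨a, ha, hPa⟩
        show C.1 ⊆ P.1
        rw [hPa]
        exact fun y hy => aux_mem_UA.1 (h hy) a ha
    refine ⟨B, ⟨⟨Iic a, aux_Iic_mem a (hAm a ha)⟩, a, ha, rfl⟩, ?_, K, ?_,
      (aux_key A B hB x hx K hKx K le_rfl).symm⟩
    · rintro P ⟨a, ha, hPa⟩
      exact (aux_max P).2 ⟨a, hAm a ha, hPa⟩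
    · rw [hB, hKx]
      exact connectedComponentIn_subset _ _

/-- every `D ∈ 𝒰(𝒰(X))` has a maximum, `D ↦ max D` and
`C ↦ {C' ∈ 𝒰(X) ∣ C' ⊆ C}` are mutually inverse order isomorphisms between `𝒰(𝒰(X))` and
`𝒰(X)`, and consequently `𝒰(𝒰(X)) ≅ 𝒰(X)`. -/
theorem stmt19 {α : Type*} [PartialOrder α] [Fintype α] :
    (∀ D ∈ scrU (↥(scrU α)), ∃ M, IsGreatest D M) ∧
    (∀ D ∈ scrU (↥(scrU α)), ∀ M, IsGreatest D M → D = Iic M) ∧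
    (∀ C : ↥(scrU α), Iic C ∈ scrU (↥(scrU α)) ∧ IsGreatest (Iic C) C) ∧
    (∀ D₁ ∈ scrU (↥(scrU α)), ∀ D₂ ∈ scrU (↥(scrU α)), ∀ M₁ M₂,
      IsGreatest D₁ M₁ → IsGreatest D₂ M₂ → (D₁ ⊆ D₂ ↔ M₁ ≤ M₂)) ∧
    Nonempty (↥(scrU (↥(scrU α))) ≃o ↥(scrU α)) := by
  have h2 : ∀ D ∈ scrU (↥(scrU α)), ∀ M, IsGreatest D M → D = Iic M := by
    intro D hD M hM
    obtain ⟨K, rfl⟩ := (aux_main_s19 D).1 hD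
    rw [isGreatest_Iic.unique hM]
  refine ⟨?_, h2, ?_, ?_, ?_⟩
  · intro D hD
    obtain ⟨K, rfl⟩ := (aux_main_s19 D).1 hD
    exact ⟨K, isGreatest_Iic⟩
  · exact fun C => ⟨(aux_main_s19 _).2 ⟨C, rfl⟩, isGreatest_Iic⟩
  · intro D₁ h₁ D₂ h₂ M₁ M₂ hM₁ hM₂
    rw [h2 D₁ h₁ M₁ hM₁, h2 D₂ h₂ M₂ hM₂, Iic_subset_Iic]
  · let f : ↥(scrU α) → ↥(scrU (↥(scrU α))) := fun C => ⟨Iic C, (aux_main_s19 _).2 ⟨C, rfl⟩⟩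
    have hf : ∀ C C', f C ≤ f C' ↔ C ≤ C' := fun C C' => Iic_subset_Iic
    have hs : Function.Surjective f := by
      rintro ⟨D, hD⟩
      obtain ⟨K, rfl⟩ := (aux_main_s19 D).1 hD
      exact ⟨K, rfl⟩
    exact ⟨(RelIso.ofSurjective (OrderEmbedding.ofMapLEIff f hf) hs).symm⟩
end
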